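/- The coefficient matrix M of the linear system defining the full representation polyhedron of an interval order is totally unimodular, where M has 3n columns indexed by variables l_1, r_1, ..., l_n, r_n, ρ_1, ..., ρ_n and rows of the following types: (−l_y + r_x) for pairs x < y; (l_x − r_y) for incomparable distinct pairs; (l_x − r_x + ρ_x); (−l_x + r_x − ρ_x); and (l_x − r_x). -/

import Mathlib

/-- Columns of the coefficient matrix: left endpoints, right endpoints, lengths. -/
abbrev FullRepCol (α : Type*) := α ⊕ α ⊕ α

/-- Rows of the coefficient matrix of the full representation polyhedron:
comparable pairs `x < y`, incomparable distinct pairs, and three rows per element. -/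
abbrev FullRepRow (α : Type*) [PartialOrder α] :=
  {p : α × α // p.1 < p.2} ⊕
  {p : α × α // p.1 ≠ p.2 ∧ ¬ p.1 < p.2 ∧ ¬ p.2 < p.1} ⊕
  α ⊕ α ⊕ α

/-- The coefficient matrix `M` of the linear system defining the full representation
polyhedron: rows `−l_y + r_x` for `x < y`; `l_x − r_y` for incomparable distinct pairs;
`l_x − r_x + ρ_x`; `−l_x + r_x − ρ_x`; and `l_x − r_x`. -/
def fullRepMatrix (α : Type*) [DecidableEq α] [PartialOrder α] :
    Matrix (FullRepRow α) (FullRepCol α) ℤ := fun row col =>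
  match row with
  | .inl ⟨(x, y), _⟩ =>
      match col with
      | .inl z => if z = y then -1 else 0
      | .inr (.inl z) => if z = x then 1 else 0
      | .inr (.inr _) => 0
  | .inr (.inl ⟨(x, y), _⟩) =>
      match col with
      | .inl z => if z = x then 1 else 0
      | .inr (.inl z) => if z = y then -1 else 0
      | .inr (.inr _) => 0
  | .inr (.inr (.inl x)) =>
      match col with
      | .inl z => if z = x then 1 else 0
      | .inr (.inl z) => if z = x then -1 else 0
      | .inr (.inr z) => if z = x then 1 else 0
  | .inr (.inr (.inr (.inl x))) =>
      match col with
      | .inl z => if z = x then -1 else 0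
      | .inr (.inl z) => if z = x then 1 else 0
      | .inr (.inr z) => if z = x then -1 else 0
  | .inr (.inr (.inr (.inr x))) =>
      match col with
      | .inl z => if z = x then 1 else 0
      | .inr (.inl z) => if z = x then -1 else 0
      | .inr (.inr _) => 0

namespace Matrix

variable {m n R : Type*} [CommRing R]

/-- Multiplying the rows of a totally unimodular matrix by signs keeps it totally unimodular. -/
lemma IsTotallyUnimodular.sign_mul_rows {A : Matrix m n R} (hA : A.IsTotallyUnimodular)
    (s : m → SignType) : (of fun i j => (s i : R) * A i j).IsTotallyUnimodular := by
  intro k f g hf hg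
  have h : ((of fun i j => (s i : R) * A i j).submatrix f g).det =
      (∏ i, (s (f i) : R)) * (A.submatrix f g).det :=
    det_mul_column (fun i => (s (f i) : R)) (A.submatrix f g)
  rw [h]
  change _ ∈ MonoidHom.mrange SignType.castHom.toMonoidHom
  exact mul_mem (prod_mem fun i _ => Set.mem_range_self (s (f i))) (hA k f g hf hg)

/-- The arc-vertex incidence matrix of a directed graph is totally unimodular. -/
lemma isTotallyUnimodular_incidence [DecidableEq n] (p q : m → n) :
    (of fun i => Pi.single (p i) 1 - Pi.single (q i) 1 : Matrix m n R).IsTotallyUnimodular := by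
  intro k f g hf hg
  induction k with
  | zero => exact ⟨1, by simp⟩
  | succ k ih =>
    set B := (of fun i => Pi.single (p i) 1 - Pi.single (q i) 1 : Matrix m n R).submatrix f g
      with hB
    have hBapply : ∀ i j, B i j = (if g j = p (f i) then 1 else 0) -
        (if g j = q (f i) then 1 else 0) := fun i j => by
      simp [hB, Pi.single_apply]
    by_cases h : ∀ i, (p (f i) ∈ Set.range g ↔ q (f i) ∈ Set.range g)
    · have hsum : ∀ a, (∑ j, if g j = a then (1 : R) else 0) =
          if a ∈ Set.range g then 1 else 0 := fun a => by
        split_ifs with ha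
        · obtain ⟨j, rfl⟩ := ha
          simp [hg.eq_iff]
        · exact Finset.sum_eq_zero fun j _ => if_neg fun hj => ha ⟨j, hj⟩
      refine ⟨0, ?_⟩
      rw [SignType.coe_zero, eq_comm]
      refine det_eq_zero_of_mulVec_eq_zero_of_mem_nonZeroDivisors (v := fun _ => 1)
        (i := 0) ?_ (one_mem _)
      ext i
      simp [mulVec, dotProduct, hBapply, hsum, h i]
    · push Not at h
      obtain ⟨i, hi⟩ := h
      obtain ⟨j, s, hs, hj⟩ : ∃ (j : Fin (k + 1)) (s : SignType),
          B i j = s ∧ ∀ l ≠ j, B i l = 0 := by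
        rcases hi with ⟨⟨j, hp⟩, hq⟩ | ⟨hp, ⟨j, hq⟩⟩
        · have hq' : ∀ l, g l ≠ q (f i) := fun l hl => hq ⟨l, hl⟩
          exact ⟨j, 1, by
            rw [hBapply, if_pos hp, if_neg (hq' j)]; simp, fun l hl => by
            simp [hBapply, hq', ← hp, hg.eq_iff, hl]⟩
        · have hp' : ∀ l, g l ≠ p (f i) := fun l hl => hp ⟨l, hl⟩
          exact ⟨j, -1, by
            rw [hBapply, if_neg (hp' j), if_pos hq]; simp, fun l hl => by
            simp [hBapply, hp', ← hq, hg.eq_iff, hl]⟩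
      rw [det_succ_row B i, Fintype.sum_eq_single j fun l hl => by simp [hj l hl], hs]
      change _ ∈ MonoidHom.mrange SignType.castHom.toMonoidHom
      refine mul_mem (mul_mem (pow_mem (Set.mem_range.2 ⟨-1, by simp⟩) _) (Set.mem_range_self s)) ?_
      exact ih _ _ (hf.comp Fin.succAbove_right_injective) (hg.comp Fin.succAbove_right_injective)

end Matrix

/-- The coefficient matrix of the full representation polyhedron of an interval order
is totally unimodular. -/
theorem stmt_9 {α : Type*} [DecidableEq α] [Fintype α] [PartialOrder α] :
    (fullRepMatrix α).IsTotallyUnimodular := by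
  let p : FullRepRow α → α ⊕ α := fun
    | .inl z => .inr z.1.1
    | .inr (.inl z) => .inl z.1.1
    | .inr (.inr (.inl x)) => .inl x
    | .inr (.inr (.inr (.inl x))) => .inl x
    | .inr (.inr (.inr (.inr x))) => .inl x
  let q : FullRepRow α → α ⊕ α := fun
    | .inl z => .inl z.1.2
    | .inr (.inl z) => .inr z.1.2
    | .inr (.inr (.inl x)) => .inr x
    | .inr (.inr (.inr (.inl x))) => .inr x
    | .inr (.inr (.inr (.inr x))) => .inr x
  -- The fourth row of an element is the negative of its third row.
  let s : FullRepRow α → SignType := fun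
    | .inr (.inr (.inr (.inl _))) => -1
    | _ => 1
  let f : FullRepRow α → FullRepRow α := fun
    | .inr (.inr (.inr (.inl x))) => .inr (.inr (.inl x))
    | i => i
  let g : FullRepCol α → (α ⊕ α) ⊕ FullRepRow α := fun
    | .inl x => .inl (.inl x)
    | .inr (.inl x) => .inl (.inr x)
    | .inr (.inr x) => .inr (.inr (.inr (.inl x)))
  classical
  have h := ((((Matrix.fromCols_one_isTotallyUnimodular_iff _).2
    (Matrix.isTotallyUnimodular_incidence (R := ℤ) p q)).submatrix f g).sign_mul_rows s)
  refine Eq.mp (congrArg _ ?_) h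
  ext i j
  rcases i with ⟨⟨x, y⟩, hxy⟩ | ⟨⟨x, y⟩, hxy⟩ | x | x | x <;> rcases j with z | z | z <;>
    simp [fullRepMatrix, p, q, s, f, g, Pi.single_apply, Matrix.one_apply] <;> grind
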